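/- arXiv:0804.3616 — 4 statements merged into one kernel-verified Lean document; each statement's English description precedes it below -/
import Mathlib

section
/- Let M be a measurable space, f : M → M a measurable map, μ an f-invariant probability measure on M, and r : M → ℝ a measurable roof function with r(x) ≥ r₀ for all x, where r₀ > 0 is a constant, and with ∫ r dμ < ∞. Define the measure ν on M_r by ν(A) = (∫ r dμ)^{-1} ∫ ( ∫_0^{r(x)} χ_A(x,s) ds ) dμ(x) for measurable A ⊆ M_r. Then ν is a probability measure and, for every T ≥ 0, the time-T map X^T of the suspension semiflow preserves ν. -/
open MeasureTheory

/-- Birkhoff sum `S_n g(x) = ∑_{j=0}^{n-1} g(f^j x)`. -/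
noncomputable def birkhoff {M : Type*} (f : M → M) (g : M → ℝ) (n : ℕ) (x : M) : ℝ :=
  ∑ j ∈ Finset.range n, g (f^[j] x)

/-- The lap number `n(x,s,T)`: the largest `n` with `S_n r(x) ≤ s + T`. -/
noncomputable def lap {M : Type*} (f : M → M) (r : M → ℝ) (x : M) (s T : ℝ) : ℕ :=
  sSup {n : ℕ | birkhoff f r n x ≤ s + T}

/-- The time-`T` map of the suspension semiflow:
`X^T(x,s) = (f^n x, s + T - S_n r(x))` with `n = n(x,s,T)`. -/
noncomputable def suspFlow {M : Type*} (f : M → M) (r : M → ℝ) (T : ℝ) (z : M × ℝ) :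
    M × ℝ :=
  (f^[lap f r z.1 z.2 T] z.1, z.2 + T - birkhoff f r (lap f r z.1 z.2 T) z.1)

/-- The (unnormalized) suspension of a measure `μ` on the base by the roof `r`:
`A ↦ ∫ (∫_0^{r x} χ_A(x,s) ds) dμ(x)`. -/
noncomputable def suspMeasureAux {M : Type*} [MeasurableSpace M] (μ : Measure M)
    (r : M → ℝ) : Measure (M × ℝ) :=
  μ.bind fun x => (volume.restrict (Set.Ico (0 : ℝ) (r x))).map (Prod.mk x)

theorem birkhoff_succ_left {M : Type*} (f : M → M) (r : M → ℝ) (n : ℕ) (x : M) :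
    birkhoff f r (n + 1) x = r x + birkhoff f r n (f x) := by
  simp only [birkhoff, Finset.sum_range_succ', Function.iterate_succ_apply, Function.iterate_zero,
    id_eq]
  ring

theorem birkhoff_strictMono {M : Type*} (f : M → M) (r : M → ℝ) (h : ∀ x, 0 < r x) (x : M) :
    StrictMono (fun n => birkhoff f r n x) := by
  apply strictMono_nat_of_lt_succ
  intro n
  simp only [birkhoff, Finset.sum_range_succ]
  linarith [h (f^[n] x)]

theorem birkhoff_ge {M : Type*} (f : M → M) (r : M → ℝ) (r₀ : ℝ) (h : ∀ x, r₀ ≤ r x) (x : M)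
    (n : ℕ) : n * r₀ ≤ birkhoff f r n x := by
  induction n with
  | zero => simp [birkhoff]
  | succ n ih =>
    simp only [birkhoff, Finset.sum_range_succ] at ih ⊢
    push_cast
    linarith [h (f^[n] x)]

theorem lap_eq_of {M : Type*} (f : M → M) (r : M → ℝ) (h : ∀ x, 0 < r x) (x : M) (s T : ℝ)
    (n : ℕ) (h1 : birkhoff f r n x ≤ s + T) (h2 : s + T < birkhoff f r (n + 1) x) :
    lap f r x s T = n := by
  have : IsGreatest {n : ℕ | birkhoff f r n x ≤ s + T} n := by
    refine ⟨h1, fun m hm => ?_⟩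
    have h3 : birkhoff f r m x < birkhoff f r (n + 1) x := lt_of_le_of_lt hm h2
    have := (birkhoff_strictMono f r h x).lt_iff_lt.1 h3
    omega
  exact this.csSup_eq

theorem lap_exists {M : Type*} (f : M → M) (r : M → ℝ) (r₀ : ℝ) (hr₀ : 0 < r₀)
    (h : ∀ x, r₀ ≤ r x) (x : M) (u : ℝ) (hu : 0 ≤ u) :
    ∃ n, birkhoff f r n x ≤ u ∧ u < birkhoff f r (n + 1) x := by
  have hex : ∃ n, u < birkhoff f r n x := by
    obtain ⟨n, hn⟩ := exists_nat_gt (u / r₀)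
    refine ⟨n, lt_of_lt_of_le ?_ (birkhoff_ge f r r₀ h x n)⟩
    rwa [div_lt_iff₀ hr₀] at hn
  classical
  obtain ⟨n, hn⟩ : ∃ n, Nat.find hex = n + 1 := by
    apply Nat.exists_eq_succ_of_ne_zero
    intro h0
    have := Nat.find_spec hex
    rw [h0] at this
    simp [birkhoff] at this
    linarith
  refine ⟨n, not_lt.1 (Nat.find_min hex (by omega)), ?_⟩
  have := Nat.find_spec hex
  rwa [hn] at this

theorem lap_neg {M : Type*} (f : M → M) (r : M → ℝ) (h : ∀ x, 0 < r x) (x : M) (s T : ℝ)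
    (hs : s + T < 0) : lap f r x s T = 0 := by
  have : {n : ℕ | birkhoff f r n x ≤ s + T} = ∅ := by
    ext n
    have h1 := (birkhoff_strictMono f r h x).monotone (Nat.zero_le n)
    have h0 : birkhoff f r 0 x = 0 := by simp [birkhoff]
    simp only [h0] at h1
    simp only [Set.mem_ofPred_eq, Set.mem_empty_iff_false, iff_false, not_le]
    linarith
  simp [lap, this]

theorem suspFlow_eq_zero {M : Type*} (f : M → M) (r : M → ℝ) (T : ℝ) (x : M) (s : ℝ) :
    suspFlow f r T (x, s) = suspFlow f r 0 (x, s + T) := by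
  simp [suspFlow, lap]

theorem suspFlow_base {M : Type*} (f : M → M) (r : M → ℝ) (h : ∀ x, 0 < r x) (x : M) (s : ℝ)
    (h0 : 0 ≤ s) (h1 : s < r x) : suspFlow f r 0 (x, s) = (x, s) := by
  have : lap f r x s 0 = 0 := lap_eq_of f r h x s 0 0 (by simpa [birkhoff]) (by simpa [birkhoff])
  simp [suspFlow, this, birkhoff]

theorem suspFlow_shift {M : Type*} (f : M → M) (r : M → ℝ) (r₀ : ℝ) (hr₀ : 0 < r₀)
    (h : ∀ x, r₀ ≤ r x) (x : M) (t : ℝ) (ht : 0 ≤ t) :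
    suspFlow f r 0 (x, t + r x) = suspFlow f r 0 (f x, t) := by
  have hp : ∀ x, 0 < r x := fun x => hr₀.trans_le (h x)
  obtain ⟨n, h1, h2⟩ := lap_exists f r r₀ hr₀ h (f x) t ht
  have e1 : lap f r (f x) t 0 = n := lap_eq_of f r hp _ _ _ _ (by simpa) (by simpa)
  have e2 : lap f r x (t + r x) 0 = n + 1 := by
    apply lap_eq_of f r hp
    · rw [birkhoff_succ_left]; linarith
    · rw [birkhoff_succ_left]; linarith
  simp only [suspFlow, e1, e2, birkhoff_succ_left, Function.iterate_succ_apply]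
  congr 1
  ring

theorem measurable_birkhoff {M : Type*} [MeasurableSpace M] (f : M → M) (hf : Measurable f)
    (r : M → ℝ) (hrm : Measurable r) (n : ℕ) : Measurable (birkhoff f r n) := by
  unfold birkhoff
  exact Finset.measurable_fun_sum _ fun j _ => hrm.comp (hf.iterate j)

theorem measurable_lap {M : Type*} [MeasurableSpace M] (f : M → M) (hf : Measurable f)
    (r : M → ℝ) (hrm : Measurable r) (r₀ : ℝ) (hr₀ : 0 < r₀) (h : ∀ x, r₀ ≤ r x) (T : ℝ) :
    Measurable (fun z : M × ℝ => lap f r z.1 z.2 T) := by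
  have hp : ∀ x, 0 < r x := fun x => hr₀.trans_le (h x)
  have hb := measurable_birkhoff f hf r hrm
  apply measurable_to_countable'
  intro n
  have : (fun z : M × ℝ => lap f r z.1 z.2 T) ⁻¹' {n} =
      ({z | z.2 + T < 0} ∩ {_z | n = 0}) ∪
      ({z | birkhoff f r n z.1 ≤ z.2 + T} ∩ {z | z.2 + T < birkhoff f r (n + 1) z.1}) := by
    ext ⟨x, s⟩
    simp only [Set.mem_preimage, Set.mem_singleton_iff, Set.mem_union, Set.mem_inter_iff,
      Set.mem_ofPred_eq]
    constructor
    · intro hl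
      rcases lt_or_ge (s + T) 0 with hs | hs
      · left; exact ⟨hs, by rw [← hl, lap_neg f r hp x s T hs]⟩
      · right
        obtain ⟨m, h1, h2⟩ := lap_exists f r r₀ hr₀ h x _ hs
        have := lap_eq_of f r hp x s T m h1 h2
        rw [← hl, this]; exact ⟨h1, h2⟩
    · rintro (⟨h1, h2⟩ | ⟨h1, h2⟩)
      · rw [h2, lap_neg f r hp x s T h1]
      · exact lap_eq_of f r hp x s T n h1 h2
  rw [this]
  have hs : Measurable (fun z : M × ℝ => z.2 + T) := by fun_prop
  refine ((measurableSet_lt hs measurable_const).inter (MeasurableSet.const _)).union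
    ((measurableSet_le ((hb n).comp measurable_fst) hs).inter
      (measurableSet_lt hs ((hb (n+1)).comp measurable_fst)))

theorem measurable_suspFlow {M : Type*} [MeasurableSpace M] (f : M → M) (hf : Measurable f)
    (r : M → ℝ) (hrm : Measurable r) (r₀ : ℝ) (hr₀ : 0 < r₀) (h : ∀ x, r₀ ≤ r x) (T : ℝ) :
    Measurable (suspFlow f r T) := by
  have hl := measurable_lap f hf r hrm r₀ hr₀ h T
  have hF : Measurable (fun p : ℕ × (M × ℝ) =>
      ((f^[p.1] p.2.1, p.2.2 + T - birkhoff f r p.1 p.2.1) : M × ℝ)) := by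
    apply measurable_from_prod_countable_right
    intro n
    exact ((hf.iterate n).comp measurable_fst).prodMk
      ((measurable_snd.add_const T).sub ((measurable_birkhoff f hf r hrm n).comp measurable_fst))
  exact hF.comp (hl.prodMk measurable_id)

theorem measurable_slice {M : Type*} [MeasurableSpace M] (A : Set (M × ℝ)) (hA : MeasurableSet A)
    (a b : M → ℝ) (ha : Measurable a) (hb : Measurable b) :
    Measurable (fun x => volume (Prod.mk x ⁻¹' A ∩ Set.Ico (a x) (b x))) := by
  have hR : MeasurableSet (A ∩ ({z : M × ℝ | a z.1 ≤ z.2} ∩ {z : M × ℝ | z.2 < b z.1})) :=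
    hA.inter ((measurableSet_le (ha.comp measurable_fst) measurable_snd).inter
      (measurableSet_lt measurable_snd (hb.comp measurable_fst)))
  exact measurable_measure_prodMk_left (ν := (volume : Measure ℝ)) hR

theorem suspMeasureAux_apply {M : Type*} [MeasurableSpace M] (μ : Measure M)
    (r : M → ℝ) (hrm : Measurable r) (A : Set (M × ℝ)) (hA : MeasurableSet A) :
    suspMeasureAux μ r A = ∫⁻ x, volume (Prod.mk x ⁻¹' A ∩ Set.Ico 0 (r x)) ∂μ := by
  have key : ∀ x, ∀ A : Set (M × ℝ), MeasurableSet A →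
      (volume.restrict (Set.Ico (0 : ℝ) (r x))).map (Prod.mk x) A =
      volume (Prod.mk x ⁻¹' A ∩ Set.Ico 0 (r x)) := by
    intro x A hA
    rw [Measure.map_apply measurable_prodMk_left hA,
      Measure.restrict_apply (measurable_prodMk_left hA)]
  unfold suspMeasureAux
  rw [Measure.bind_apply hA]
  · simp_rw [key _ A hA]
  · apply Measurable.aemeasurable
    apply Measure.measurable_of_measurable_coe
    intro B hB
    simp_rw [key _ B hB]
    exact measurable_slice B hB _ _ measurable_const hrm

theorem vol_split (B : Set ℝ) (a b c : ℝ) (hab : a ≤ b) (hbc : b ≤ c) :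
    volume (B ∩ Set.Ico a c) = volume (B ∩ Set.Ico a b) + volume (B ∩ Set.Ico b c) := by
  rw [← measure_inter_add_sdiff (B ∩ Set.Ico a c) (measurableSet_Ico (a := a) (b := b))]
  congr 2
  · ext t; simp only [Set.mem_inter_iff, Set.mem_Ico]; grind
  · ext t; simp only [Set.mem_inter_iff, Set.mem_Ico, Set.mem_sdiff]; grind

/-- If `μ` is an `f`-invariant probability measure and `r ≥ r₀ > 0` is `μ`-integrable,
then the normalized measure `ν = (∫ r dμ)⁻¹ (μ ⋉ Leb¹)` on the suspension space is a
probability measure invariant under every time-`T` map of the suspension semiflow. -/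
theorem suspMeasure_isProbability_and_invariant {M : Type*} [MeasurableSpace M]
    (f : M → M) (hf : Measurable f) (μ : Measure M) [IsProbabilityMeasure μ]
    (hinv : MeasurePreserving f μ μ)
    (r : M → ℝ) (hrm : Measurable r) (r₀ : ℝ) (hr₀ : 0 < r₀) (hr : ∀ x, r₀ ≤ r x)
    (hri : Integrable r μ) :
    IsProbabilityMeasure
      ((ENNReal.ofReal (∫ x, r x ∂μ))⁻¹ • suspMeasureAux μ r) ∧
    ∀ T : ℝ, 0 ≤ T →
      MeasurePreserving (suspFlow f r T)
        ((ENNReal.ofReal (∫ x, r x ∂μ))⁻¹ • suspMeasureAux μ r)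
        ((ENNReal.ofReal (∫ x, r x ∂μ))⁻¹ • suspMeasureAux μ r) := by
  have hp : ∀ x, 0 < r x := fun x => hr₀.trans_le (hr x)
  have hmass : suspMeasureAux μ r Set.univ = ENNReal.ofReal (∫ x, r x ∂μ) := by
    rw [suspMeasureAux_apply μ r hrm _ MeasurableSet.univ,
      ofReal_integral_eq_lintegral_ofReal hri (Filter.Eventually.of_forall fun x => (hp x).le)]
    simp
  have hpos : 0 < ∫ x, r x ∂μ := by
    have : ∫ _x, r₀ ∂μ ≤ ∫ x, r x ∂μ := integral_mono (integrable_const _) hri hr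
    simp at this
    linarith
  refine ⟨⟨?_⟩, fun T hT => ?_⟩
  · rw [Measure.smul_apply, hmass, smul_eq_mul]
    exact ENNReal.inv_mul_cancel (by simpa using hpos) ENNReal.ofReal_ne_top
  have hm := measurable_suspFlow f hf r hrm r₀ hr₀ hr
  have main : MeasurePreserving (suspFlow f r T) (suspMeasureAux μ r) (suspMeasureAux μ r) := by
    refine ⟨hm T, ?_⟩
    ext A hA
    rw [Measure.map_apply (hm T) hA, suspMeasureAux_apply μ r hrm _ (hm T hA),
      suspMeasureAux_apply μ r hrm _ hA]
    set B := suspFlow f r 0 ⁻¹' A with hB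
    have hBm : MeasurableSet B := hm 0 hA
    have e1 : ∀ x, volume (Prod.mk x ⁻¹' (suspFlow f r T ⁻¹' A) ∩ Set.Ico 0 (r x)) =
        volume (Prod.mk x ⁻¹' B ∩ Set.Ico T (T + r x)) := by
      intro x
      rw [← measure_preimage_add_right volume T (Prod.mk x ⁻¹' B ∩ Set.Ico T (T + r x))]
      congr 1
      ext t
      simp only [Set.mem_inter_iff, Set.mem_preimage, Set.mem_Ico, hB, suspFlow_eq_zero f r T]
      grind
    have e2 : ∀ x, volume (Prod.mk x ⁻¹' A ∩ Set.Ico 0 (r x)) =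
        volume (Prod.mk x ⁻¹' B ∩ Set.Ico 0 (r x)) := by
      intro x
      congr 1
      ext t
      simp only [Set.mem_inter_iff, Set.mem_preimage, Set.mem_Ico, hB]
      refine and_congr_left fun ht => ?_
      rw [suspFlow_base f r hp x t ht.1 ht.2]
    have e3 : ∀ x, volume (Prod.mk x ⁻¹' B ∩ Set.Ico (r x) (T + r x)) =
        volume (Prod.mk (f x) ⁻¹' B ∩ Set.Ico 0 T) := by
      intro x
      rw [← measure_preimage_add_right volume (r x)
        (Prod.mk x ⁻¹' B ∩ Set.Ico (r x) (T + r x))]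
      congr 1
      ext t
      simp only [Set.mem_inter_iff, Set.mem_preimage, Set.mem_Ico, hB]
      have : (r x ≤ t + r x ∧ t + r x < T + r x) ↔ (0 ≤ t ∧ t < T) := by grind
      rw [this]
      refine and_congr_left fun ht => ?_
      rw [suspFlow_shift f r r₀ hr₀ hr x t ht.1]
    simp_rw [e1, e2]
    have hT0 : Measurable (fun x => volume (Prod.mk x ⁻¹' B ∩ Set.Ico 0 T)) :=
      measurable_slice B hBm (fun _ => 0) (fun _ => T) measurable_const measurable_const
    have e4 : ∀ x, volume (Prod.mk x ⁻¹' B ∩ Set.Ico 0 T) +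
        volume (Prod.mk x ⁻¹' B ∩ Set.Ico T (T + r x)) =
        volume (Prod.mk (f x) ⁻¹' B ∩ Set.Ico 0 T) +
        volume (Prod.mk x ⁻¹' B ∩ Set.Ico 0 (r x)) := by
      intro x
      have := hp x
      rw [← vol_split _ 0 T (T + r x) hT (by linarith),
        vol_split _ 0 (r x) (T + r x) (by linarith) (by linarith), e3, add_comm]
    have hT1 : Measurable (fun x => volume (Prod.mk (f x) ⁻¹' B ∩ Set.Ico 0 T)) := hT0.comp hf
    have e5 := lintegral_congr (μ := μ) e4
    rw [lintegral_add_left hT0, lintegral_add_left hT1,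
      hinv.lintegral_comp hT0] at e5
    refine (ENNReal.add_right_inj ?_).1 e5
    refine ne_top_of_le_ne_top (b := ENNReal.ofReal T) ENNReal.ofReal_ne_top ?_
    calc _ ≤ ∫⁻ _x, ENNReal.ofReal T ∂μ := by
          apply lintegral_mono
          intro x
          refine (measure_mono Set.inter_subset_right).trans ?_
          simp
      _ = ENNReal.ofReal T := by simp
  refine ⟨hm T, ?_⟩
  rw [Measure.map_smul, main.map_eq]
end

section
/- Let M be a measurable space, f : M → M a measurable map, and r : M → ℝ a measurable roof function with r(x) ≥ r₀ for all x, where r₀ > 0 is a constant. Let ψ : M_r → ℝ be measurable with |ψ| ≤ C everywhere, and set φ(x) = ∫_0^{r(x)} ψ(x,t) dt. Then for every (x,s) ∈ M_r and T > 0, writing n = n(x,s,T), one has | ∫_0^T ψ(X^t(x,s)) dt − S_n φ(x) | ≤ C·( r(x) + r(f^n(x)) ). -/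
open MeasureTheory intervalIntegral

theorem birkhoff_strictMono_aux {M : Type*} (f : M → M) (r : M → ℝ) (r₀ : ℝ) (hr₀ : 0 < r₀)
    (hr : ∀ x, r₀ ≤ r x) (x : M) : StrictMono fun n => birkhoff f r n x := by
  refine strictMono_nat_of_lt_succ fun n => ?_
  simp only [birkhoff, Finset.sum_range_succ]
  linarith [hr (f^[n] x)]

theorem birkhoff_lower_aux {M : Type*} (f : M → M) (r : M → ℝ) (r₀ : ℝ)
    (hr : ∀ x, r₀ ≤ r x) (x : M) (n : ℕ) : n * r₀ ≤ birkhoff f r n x := by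
  have := Finset.card_nsmul_le_sum (Finset.range n) (fun j => r (f^[j] x)) r₀ (fun j _ => hr _)
  simpa [birkhoff] using this

theorem lap_eq_aux {M : Type*} (f : M → M) (r : M → ℝ) (r₀ : ℝ) (hr₀ : 0 < r₀)
    (hr : ∀ x, r₀ ≤ r x) (x : M) (s T : ℝ) (n : ℕ) (h1 : birkhoff f r n x ≤ s + T)
    (h2 : s + T < birkhoff f r (n + 1) x) : lap f r x s T = n := by
  have hm := birkhoff_strictMono_aux f r r₀ hr₀ hr x
  refine IsGreatest.csSup_eq ⟨h1, fun m hmm => ?_⟩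
  have h3 : birkhoff f r m x < birkhoff f r (n + 1) x := lt_of_le_of_lt hmm h2
  exact Nat.lt_succ_iff.mp (hm.lt_iff_lt.mp h3)

theorem lap_spec_aux {M : Type*} (f : M → M) (r : M → ℝ) (r₀ : ℝ) (hr₀ : 0 < r₀)
    (hr : ∀ x, r₀ ≤ r x) (x : M) (s T : ℝ) (h : 0 ≤ s + T) :
    birkhoff f r (lap f r x s T) x ≤ s + T ∧ s + T < birkhoff f r (lap f r x s T + 1) x := by
  have hb : BddAbove {n : ℕ | birkhoff f r n x ≤ s + T} := by
    obtain ⟨N, hN⟩ := exists_nat_gt ((s + T) / r₀)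
    refine ⟨N, fun m hm => ?_⟩
    have h1 := birkhoff_lower_aux f r r₀ hr x m
    have h2 : (m : ℝ) ≤ (s + T) / r₀ := by
      rw [le_div_iff₀ hr₀]
      exact h1.trans hm
    exact_mod_cast (h2.trans hN.le)
  constructor
  · exact Nat.sSup_mem (s := {n : ℕ | birkhoff f r n x ≤ s + T}) ⟨0, by simpa [birkhoff] using h⟩ hb
  · by_contra hc
    have h3 : lap f r x s T + 1 ≤ lap f r x s T := le_csSup hb (not_lt.mp hc)
    omega

/-- If `|ψ| ≤ C` and `φ(x) = ∫_0^{r x} ψ(x,t) dt`, then for `0 ≤ s < r x` and `T > 0`,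
with `n = n(x,s,T)`, the time integral of `ψ` along the semiflow differs from the Birkhoff
sum `S_n φ(x)` by at most `C (r x + r (fⁿ x))`. -/
theorem suspFlow_integral_birkhoff_error {M : Type*} [MeasurableSpace M]
    (f : M → M) (hf : Measurable f)
    (r : M → ℝ) (hrm : Measurable r) (r₀ : ℝ) (hr₀ : 0 < r₀) (hr : ∀ x, r₀ ≤ r x)
    (ψ : M × ℝ → ℝ) (hψm : Measurable ψ) (C : ℝ) (hψb : ∀ z, |ψ z| ≤ C)
    (φ : M → ℝ) (hφ : ∀ x, φ x = ∫ t in (0 : ℝ)..(r x), ψ (x, t))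
    (x : M) (s T : ℝ) (hs : 0 ≤ s) (hsr : s < r x) (hT : 0 < T) :
    |(∫ t in (0 : ℝ)..T, ψ (suspFlow f r t (x, s))) -
        birkhoff f φ (lap f r x s T) x| ≤
      C * (r x + r (f^[lap f r x s T] x)) := by
  have hC : 0 ≤ C := (abs_nonneg _).trans (hψb (x, 0))
  set n := lap f r x s T with hn
  obtain ⟨hn1, hn2⟩ := lap_spec_aux f r r₀ hr₀ hr x s T (by linarith)
  rw [← hn] at hn1 hn2
  have hmono := birkhoff_strictMono_aux f r r₀ hr₀ hr x
  have hS0 : birkhoff f r 0 x = 0 := by simp [birkhoff]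
  have hSs : ∀ k, birkhoff f r (k + 1) x = birkhoff f r k x + r (f^[k] x) := fun k => by
    simp [birkhoff, Finset.sum_range_succ]
  have hSnn : ∀ k, 0 ≤ birkhoff f r k x := fun k => hS0 ▸ hmono.monotone (Nat.zero_le k)
  set G : ℝ → ℝ := fun u => ψ (suspFlow f r u (x, 0)) with hG
  have hGb : ∀ u, ‖G u‖ ≤ C := fun u => hψb _
  -- the flow integral is a translated integral of `G`
  have hshift : (∫ t in (0 : ℝ)..T, ψ (suspFlow f r t (x, s))) = ∫ u in s..(s + T), G u := by
    have h1 : ∀ t, ψ (suspFlow f r t (x, s)) = G (s + t) := fun t => by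
      simp [hG, suspFlow, lap]
    simp only [h1]
    rw [intervalIntegral.integral_comp_add_left]
    simp
  -- on each lap `G` is explicit
  have hEq : ∀ k, Set.EqOn (fun u => ψ (f^[k] x, u - birkhoff f r k x)) G
      (Set.uIoo (birkhoff f r k x) (birkhoff f r (k + 1) x)) := by
    intro k u hu
    rw [Set.uIoo_of_le (hmono.monotone (Nat.le_succ k))] at hu
    have h1 : lap f r x 0 u = k :=
      lap_eq_aux f r r₀ hr₀ hr x 0 u k (by linarith [hu.1]) (by linarith [hu.2])
    simp [hG, suspFlow, h1]
  have hint : ∀ k, IntervalIntegrable G volume (birkhoff f r k x) (birkhoff f r (k + 1) x) := by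
    intro k
    refine IntervalIntegrable.congr_uIoo ?_ (hEq k)
    refine (intervalIntegrable_const (c := C)).mono_fun ?_ ?_
    · have : Measurable fun u : ℝ => ψ (f^[k] x, u - birkhoff f r k x) := by fun_prop
      exact this.aestronglyMeasurable
    · refine Filter.Eventually.of_forall fun u => ?_
      have := hψb (f^[k] x, u - birkhoff f r k x)
      simpa [abs_of_nonneg hC] using this
  have hval : ∀ k, ∫ u in (birkhoff f r k x)..(birkhoff f r (k + 1) x), G u = φ (f^[k] x) := by
    intro k
    rw [← intervalIntegral.integral_congr_uIoo (hEq k),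
      intervalIntegral.integral_comp_sub_right (fun v => ψ (f^[k] x, v)), hφ, hSs k]
    simp
  have hsum : birkhoff f φ n x = ∫ u in (0 : ℝ)..(birkhoff f r n x), G u := by
    rw [← hS0, ← intervalIntegral.sum_integral_adjacent_intervals
      (a := fun k => birkhoff f r k x) (fun k _ => hint k)]
    simp only [hval]
    rfl
  have hbig : IntervalIntegrable G volume 0 (birkhoff f r (n + 1) x) := by
    have := IntervalIntegrable.trans_iterate (a := fun k => birkhoff f r k x) (n := n + 1)
      (fun k _ => hint k)
    simpa [hS0] using this
  have hsub : ∀ a b, 0 ≤ a → 0 ≤ b → a ≤ birkhoff f r (n + 1) x → b ≤ birkhoff f r (n + 1) x →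
      IntervalIntegrable G volume a b := by
    intro a b ha hb ha' hb'
    refine hbig.mono_set ?_
    rw [Set.uIcc_of_le (hSnn (n + 1))]
    exact Set.uIcc_subset_Icc ⟨ha, ha'⟩ ⟨hb, hb'⟩
  have hnn := hSnn n
  have hle : birkhoff f r n x ≤ birkhoff f r (n + 1) x := hmono.monotone (Nat.le_succ n)
  have e1 := intervalIntegral.integral_add_adjacent_intervals
    (hsub 0 s le_rfl hs (by linarith) (by linarith))
    (hsub s (s + T) hs (by linarith) (by linarith) (by linarith))
  have e2 := intervalIntegral.integral_add_adjacent_intervals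
    (hsub 0 (birkhoff f r n x) le_rfl hnn (by linarith) hle)
    (hsub (birkhoff f r n x) (s + T) hnn (by linarith) hle (by linarith))
  have b1 : ‖∫ u in (0 : ℝ)..s, G u‖ ≤ C * |s - 0| :=
    intervalIntegral.norm_integral_le_of_norm_le_const fun u _ => hGb u
  have b2 : ‖∫ u in (birkhoff f r n x)..(s + T), G u‖ ≤ C * |s + T - birkhoff f r n x| :=
    intervalIntegral.norm_integral_le_of_norm_le_const fun u _ => hGb u
  rw [Real.norm_eq_abs, sub_zero, abs_of_nonneg hs] at b1
  rw [Real.norm_eq_abs, abs_of_nonneg (by linarith : 0 ≤ s + T - birkhoff f r n x)] at b2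
  have c1 : C * s ≤ C * r x := mul_le_mul_of_nonneg_left hsr.le hC
  have c2 : C * (s + T - birkhoff f r n x) ≤ C * r (f^[n] x) :=
    mul_le_mul_of_nonneg_left (by linarith [hSs n]) hC
  rw [hshift, hsum, mul_add]
  rw [abs_le] at b1 b2 ⊢
  constructor <;> linarith [b1.1, b1.2, b2.1, b2.2]
end

section
/- Let Λ and M be metric spaces, R : Λ → Λ and f : M → M maps, P : Λ → M a surjection with P ∘ R = f ∘ P, and σ : M → Λ a section with P ∘ σ = id_M. Assume there are constants C > 0 and λ ∈ (0,1) such that whenever P(x) = P(y) one has d(R^j(x), R^j(y)) ≤ C λ^j for all j ≥ 0. Let φ : Λ → ℝ be bounded and uniformly continuous and let c ∈ ℝ. Then for every ε > 0 there exists N ∈ ℕ such that for all n ≥ N, { x ∈ Λ : | (1/n) S_n^R φ(x) − c | > 2ε } ⊆ P^{-1}( { y ∈ M : | (1/n) S_n^R φ(σ(y)) − c | > ε } ), where S_n^R φ(z) = Σ_{j=0}^{n-1} φ(R^j(z)). -/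
/-- Birkhoff sum `S_n^R φ(z) = ∑_{j=0}^{n-1} φ(R^j z)`. -/
noncomputable def birkhoffR {Λ : Type*} (R : Λ → Λ) (φ : Λ → ℝ) (n : ℕ) (z : Λ) : ℝ :=
  ∑ j ∈ Finset.range n, φ (R^[j] z)

/-- If `P` semiconjugates `R` to `f` (`P ∘ R = f ∘ P`), `σ` is a section of `P`
(`P ∘ σ = id`), and points on the same fiber of `P` approach each other exponentially
fast under `R`, then for a bounded uniformly continuous `φ`, any `c ∈ ℝ` and `ε > 0`,
for all large `n` the `2ε`-deviation set of the Birkhoff averages of `φ` is contained in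
the `P`-preimage of the `ε`-deviation set along the section. -/
theorem deviation_set_reduction {Λ M : Type*} [MetricSpace Λ] [MetricSpace M]
    (R : Λ → Λ) (f : M → M) (P : Λ → M) (hPsurj : Function.Surjective P)
    (hsemi : P ∘ R = f ∘ P) (σ : M → Λ) (hsec : P ∘ σ = id)
    (C lam : ℝ) (hC : 0 < C) (hlam0 : 0 < lam) (hlam1 : lam < 1)
    (hfib : ∀ x y : Λ, P x = P y → ∀ j : ℕ, dist (R^[j] x) (R^[j] y) ≤ C * lam ^ j)
    (φ : Λ → ℝ) (B : ℝ) (hφb : ∀ z, |φ z| ≤ B) (hφu : UniformContinuous φ) (c : ℝ) :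
    ∀ ε > (0 : ℝ), ∃ N : ℕ, ∀ n : ℕ, N ≤ n →
      {x : Λ | 2 * ε < |(1 / (n : ℝ)) * birkhoffR R φ n x - c|} ⊆
        P ⁻¹' {y : M | ε < |(1 / (n : ℝ)) * birkhoffR R φ n (σ y) - c|} := by
  intro ε hε
  obtain ⟨δ, hδ, hφδ⟩ := Metric.uniformContinuous_iff.1 hφu (ε / 2) (by positivity)
  obtain ⟨K, hK⟩ := exists_pow_lt_of_lt_one (div_pos hδ hC) hlam1
  obtain ⟨N, hN⟩ := exists_nat_gt (4 * B * K / ε)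
  refine ⟨max (max N K) 1, fun n hn x hx => ?_⟩
  have hnN : N ≤ n := by omega
  have hnK : K ≤ n := by omega
  have hn1 : 1 ≤ n := by omega
  have hn0 : (0 : ℝ) < n := by exact_mod_cast hn1
  have hP : P x = P (σ (P x)) := (congrFun hsec (P x)).symm
  simp only [Set.mem_preimage, Set.mem_setOf_eq] at hx ⊢
  generalize σ (P x) = y at hP ⊢
  have hd := hfib x y hP
  have hterm : ∀ j, |φ (R^[j] x) - φ (R^[j] y)| ≤ 2 * B := fun j => by
    have h1 := abs_le.1 (hφb (R^[j] x))
    have h2 := abs_le.1 (hφb (R^[j] y))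
    rw [abs_le]
    constructor <;> linarith
  have htail : ∀ j, K ≤ j → |φ (R^[j] x) - φ (R^[j] y)| ≤ ε / 2 := fun j hj => by
    have h1 : lam ^ j ≤ lam ^ K := pow_le_pow_of_le_one hlam0.le hlam1.le hj
    have h2 : C * lam ^ j < δ := by
      rw [lt_div_iff₀ hC] at hK
      nlinarith
    have := hφδ ((hd j).trans_lt h2)
    rw [Real.dist_eq] at this
    exact this.le
  have key : ∀ k : ℕ, ∑ j ∈ Finset.range k, |φ (R^[j] x) - φ (R^[j] y)| ≤ k * (2 * B) :=
    fun k => by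
      refine (Finset.sum_le_sum fun j _ => hterm j).trans ?_
      simp
  have key2 : ∀ m : ℕ, ∑ j ∈ Finset.range (K + m), |φ (R^[j] x) - φ (R^[j] y)|
      ≤ K * (2 * B) + m * (ε / 2) := fun m => by
    induction m with
    | zero => simpa using key K
    | succ m ih =>
      rw [← add_assoc, Finset.sum_range_succ]
      have := htail (K + m) (by omega)
      push_cast
      linarith
  have hS : |birkhoffR R φ n x - birkhoffR R φ n y| ≤ n * ε := by
    unfold birkhoffR
    rw [← Finset.sum_sub_distrib]
    refine (Finset.abs_sum_le_sum_abs _ _).trans ?_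
    obtain ⟨m, rfl⟩ := Nat.exists_eq_add_of_le hnK
    refine (key2 m).trans ?_
    rw [div_lt_iff₀ hε] at hN
    have h3 : (N : ℝ) ≤ ((K + m : ℕ) : ℝ) := by exact_mod_cast hnN
    have h4 := mul_le_mul_of_nonneg_right h3 hε.le
    have h5 : (0 : ℝ) ≤ K * ε := by positivity
    push_cast at h4 ⊢
    linarith
  have hA : |1 / (n : ℝ) * birkhoffR R φ n x - 1 / (n : ℝ) * birkhoffR R φ n y| ≤ ε := by
    rw [← mul_sub, abs_mul, abs_of_pos (by positivity), one_div, inv_mul_le_iff₀ hn0]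
    exact hS
  have := abs_sub_le (1 / (n : ℝ) * birkhoffR R φ n x) (1 / (n : ℝ) * birkhoffR R φ n y) c
  linarith
end

section
/- Let Y be a metric space, λ a finite Borel measure on Y, ν a Borel probability measure on Y, and (X^t)_{t ≥ 0} a semiflow on Y such that for every bounded continuous ψ : Y → ℝ and every ε > 0 one has limsup_{T→∞} (1/T) log λ{ z ∈ Y : | (1/T) ∫_0^T ψ(X^t(z)) dt − ∫ ψ dν | > ε } < 0. Then for every compact set K ⊆ Y with ν(K) < 1, limsup_{T→∞} (1/T) log λ{ z ∈ K : X^t(z) ∈ K for all t ∈ [0,T] } < 0. -/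
open MeasureTheory Filter intervalIntegral
open scoped Topology ENNReal

/-- If a semiflow `(X^t)_{t ≥ 0}` on a metric space `Y` satisfies an exponential large
deviation upper bound (w.r.t. a finite reference Borel measure `λ` and a Borel
probability measure `ν`) for the time averages of every bounded continuous observable,
then the measure of the set of points of a compact set `K` with `ν(K) < 1` whose orbit
stays in `K` up to time `T` decays exponentially fast in `T`. -/
theorem escape_rate_from_large_deviations {Y : Type*} [MetricSpace Y]
    [MeasurableSpace Y] [BorelSpace Y]
    (lam : Measure Y) [IsFiniteMeasure lam] (ν : Measure Y) [IsProbabilityMeasure ν]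
    (X : ℝ → Y → Y)
    (hX0 : X 0 = id)
    (hXsemi : ∀ t t' : ℝ, 0 ≤ t → 0 ≤ t' → X (t + t') = X t ∘ X t')
    (hXmeas : Measurable fun p : ℝ × Y => X p.1 p.2)
    (hld : ∀ ψ : Y → ℝ, Continuous ψ → (∃ C : ℝ, ∀ z, |ψ z| ≤ C) → ∀ ε > (0 : ℝ),
      limsup (fun T : ℝ =>
          ENNReal.log (lam {z : Y |
              ε < |(1 / T) * (∫ t in (0 : ℝ)..T, ψ (X t z)) - ∫ z, ψ z ∂ν|}) /
            (T : EReal))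
        atTop < 0) :
    ∀ K : Set Y, IsCompact K → ν K < 1 →
      limsup (fun T : ℝ =>
          ENNReal.log (lam {z : Y | z ∈ K ∧ ∀ t : ℝ, 0 ≤ t → t ≤ T → X t z ∈ K}) /
            (T : EReal))
        atTop < 0 := by
  intro K hK hν
  have key : ∃ ψ : Y → ℝ, Continuous ψ ∧ (∀ z, |ψ z| ≤ 1) ∧ (∀ z ∈ K, ψ z = 0) ∧
      0 < ∫ z, ψ z ∂ν := by
    rcases K.eq_empty_or_nonempty with rfl | hne
    · exact ⟨fun _ => 1, continuous_const, by simp, by simp, by simp⟩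
    · have hc : Continuous (fun z => min 1 (Metric.infDist z K)) :=
        continuous_const.min (Metric.continuous_infDist_pt K)
      have h0 : ∀ z, 0 ≤ min 1 (Metric.infDist z K) := fun z =>
        le_min zero_le_one Metric.infDist_nonneg
      have hb : ∀ z, |min 1 (Metric.infDist z K)| ≤ 1 := fun z => by
        rw [abs_of_nonneg (h0 z)]; exact min_le_left _ _
      refine ⟨_, hc, hb, ?_, ?_⟩
      · intro z hz
        simp [Metric.infDist_zero_of_mem hz]
      · rw [integral_pos_iff_support_of_nonneg h0]
        · have hs : Function.support (fun z => min 1 (Metric.infDist z K)) = Kᶜ := by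
            ext z
            simp only [Function.mem_support, Set.mem_compl_iff]
            rw [hK.isClosed.mem_iff_infDist_zero hne]
            have := Metric.infDist_nonneg (x := z) (s := K)
            constructor
            · intro h h'
              apply h
              simp [h']
            · intro h
              have h2 : 0 < Metric.infDist z K := lt_of_le_of_ne this (Ne.symm h)
              exact (lt_min one_pos h2).ne'
          rw [hs, prob_compl_eq_one_sub hK.isClosed.measurableSet]
          exact tsub_pos_of_lt hν
        · exact Integrable.of_bound hc.measurable.aestronglyMeasurable 1
            (Eventually.of_forall hb)
  obtain ⟨ψ, hc, hb, hz, hpos⟩ := key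
  refine lt_of_le_of_lt ?_ (hld ψ hc ⟨1, hb⟩ ((∫ z, ψ z ∂ν) / 2) (by positivity))
  refine limsup_le_limsup ?_
  filter_upwards [eventually_gt_atTop (0 : ℝ)] with T hT
  refine EReal.div_le_div_right_of_nonneg (by exact_mod_cast hT.le) ?_
  refine ENNReal.log_monotone (measure_mono ?_)
  rintro z ⟨-, h⟩
  have hi : ∫ t in (0 : ℝ)..T, ψ (X t z) = 0 := by
    rw [intervalIntegral.integral_congr (g := fun _ => (0 : ℝ))]
    · simp
    · intro t ht
      rw [Set.uIcc_of_le hT.le] at ht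
      exact hz _ (h t ht.1 ht.2)
  simp only [Set.mem_setOf_eq, hi, mul_zero, zero_sub, abs_neg, abs_of_pos hpos]
  linarith
end
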